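/- Weighted Hardy–Littlewood–Sobolev inequality for the Riesz potential I₁ with an L² weight: There exists a universal constant C₀ > 0 such that for every measurable weight V : ℂ → (0,∞) with V ∈ L²(ℂ) and every measurable f : ℂ → [0,∞) with ∫_ℂ f(z)² V(z)^{−1} dv_z < ∞, one has ∫_ℂ (∫_ℂ f(ζ)/|ζ−z| dv_ζ)² V(z) dv_z ≤ C₀² (∫_ℂ V(z)² dv_z) (∫_ℂ f(z)² V(z)^{−1} dv_z). Equivalently, ‖I₁f‖_{L²_V(ℂ)} ≤ C₀ ‖V‖_{L²(ℂ)} ‖f‖_{L²_{V^{−1}}(ℂ)}. -/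

import Mathlib

open MeasureTheory

/-- A radial majorant: a multiple of `min (a ^ 6 / r) (r⁻¹ ^ 4)`, whose integral over the plane
in polar coordinates is elementary. -/
noncomputable def rieszMajorant (a r : ℝ) : ℝ :=
  2 * a ^ 6 / (r * (1 + (a ^ 2 * r) ^ 2))

lemma rieszMajorant_nonneg (a : ℝ) {r : ℝ} (hr : 0 ≤ r) : 0 ≤ rieszMajorant a r := by
  unfold rieszMajorant; positivity

lemma mul_div_le_rieszMajorant {a b r : ℝ} (ha : 0 ≤ a) (hb : 0 ≤ b) (hr : 0 < r)
    (hba : b ≤ a) (h : a * b * r ≤ 1) : a ^ 3 * b ^ 3 / r ≤ rieszMajorant a r := by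
  have hden : 0 < 1 + (a ^ 2 * r) ^ 2 := by positivity
  have h3 : b ^ 3 ≤ a ^ 3 := by gcongr
  have hsq : (a * b * r) ^ 2 ≤ 1 := pow_le_one₀ (by positivity) h
  have hmul : b ^ 3 * (a ^ 2 * r) ^ 2 ≤ a ^ 3 := by
    calc b ^ 3 * (a ^ 2 * r) ^ 2 = (a * b * r) ^ 2 * (b * a ^ 2) := by ring
      _ ≤ 1 * (a * a ^ 2) := by gcongr
      _ = a ^ 3 := by ring
  have hkey : b ^ 3 * (1 + (a ^ 2 * r) ^ 2) ≤ 2 * a ^ 3 := by linarith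
  rw [rieszMajorant, div_le_div_iff₀ hr (by positivity)]
  calc a ^ 3 * b ^ 3 * (r * (1 + (a ^ 2 * r) ^ 2))
      = a ^ 3 * r * (b ^ 3 * (1 + (a ^ 2 * r) ^ 2)) := by ring
    _ ≤ a ^ 3 * r * (2 * a ^ 3) := by gcongr
    _ = 2 * a ^ 6 * r := by ring

/-- The pointwise estimate which, after integration, gives the Hardy–Littlewood–Sobolev
inequality for the kernel `|x - y|⁻¹` on the plane. -/
lemma mul_div_le_add_rieszMajorant {a b r : ℝ} (ha : 0 ≤ a) (hb : 0 ≤ b) (hr : 0 ≤ r) :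
    a ^ 3 * b ^ 3 / r ≤ a ^ 4 * b ^ 4 + rieszMajorant a r + rieszMajorant b r := by
  have hA := rieszMajorant_nonneg a hr
  have hB := rieszMajorant_nonneg b hr
  have hP : 0 ≤ a ^ 4 * b ^ 4 := by positivity
  rcases hr.eq_or_lt with rfl | hr
  · simpa using by linarith
  rcases le_total (a * b * r) 1 with h | h
  · rcases le_total b a with hba | hab
    · linarith [mul_div_le_rieszMajorant ha hb hr hba h]
    · have := mul_div_le_rieszMajorant hb ha hr hab (by linarith [mul_comm a b])
      rw [mul_comm (b ^ 3)] at this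
      linarith
  · have : a ^ 3 * b ^ 3 / r ≤ a ^ 4 * b ^ 4 := by
      rw [div_le_iff₀ hr]
      calc a ^ 3 * b ^ 3 = a ^ 3 * b ^ 3 * 1 := by ring
        _ ≤ a ^ 3 * b ^ 3 * (a * b * r) := by gcongr
        _ = a ^ 4 * b ^ 4 * r := by ring
    linarith

lemma lintegral_rieszMajorant_norm {a : ℝ} (ha : 0 ≤ a) :
    ∫⁻ z : ℂ, ENNReal.ofReal (rieszMajorant a ‖z‖) = ENNReal.ofReal (2 * Real.pi ^ 2 * a ^ 4) := by
  rcases ha.eq_or_lt with rfl | ha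
  · simp [rieszMajorant]
  have hradial : Set.EqOn (fun r : ℝ => 2 * a ^ 6 * (1 + (a ^ 2 * r) ^ 2)⁻¹)
      (fun r => r ^ (Module.finrank ℝ ℂ - 1) • rieszMajorant a r) (Set.Ioi 0) := by
    intro r hr
    have hr : 0 < r := hr
    simp only [Complex.finrank_real_complex, rieszMajorant, smul_eq_mul]
    field_simp
    norm_num
  have hint : IntegrableOn (fun r : ℝ => 2 * a ^ 6 * (1 + (a ^ 2 * r) ^ 2)⁻¹) (Set.Ioi 0) :=
    ((integrable_inv_one_add_sq.comp_mul_left' (by positivity : a ^ 2 ≠ 0)).const_mul _).integrableOn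
  have hIntegrable : Integrable (fun z : ℂ => rieszMajorant a ‖z‖) :=
    (integrable_fun_norm_addHaar volume).2 (hint.congr_fun hradial measurableSet_Ioi)
  rw [← ofReal_integral_eq_lintegral_ofReal hIntegrable
    (.of_forall fun z => rieszMajorant_nonneg a (norm_nonneg z)), integral_fun_norm_addHaar,
    ← setIntegral_congr_fun measurableSet_Ioi hradial, integral_const_mul,
    integral_comp_mul_left_Ioi (fun r => (1 + r ^ 2)⁻¹) 0 (by positivity : 0 < a ^ 2), mul_zero,
    integral_Ioi_inv_one_add_sq]
  congr 1
  simp only [Complex.finrank_real_complex, Measure.real, Complex.volume_ball]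
  simp
  field_simp

lemma lintegral_rieszMajorant_dist {a : ℝ} (ha : 0 ≤ a) (w : ℂ) :
    ∫⁻ z : ℂ, ENNReal.ofReal (rieszMajorant a (dist z w))
      = ENNReal.ofReal (2 * Real.pi ^ 2) * ENNReal.ofReal (a ^ 4) := by
  simp_rw [dist_eq_norm]
  rw [lintegral_sub_right_eq_self (fun z : ℂ => ENNReal.ofReal (rieszMajorant a ‖z‖)) w,
    lintegral_rieszMajorant_norm ha, ENNReal.ofReal_mul (by positivity)]

/-- An additive form of the Hardy–Littlewood–Sobolev inequality on the plane. -/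
lemma lintegral_lintegral_cube_mul_cube_div_dist_le {a b : ℂ → ℝ} (ha : Measurable a)
    (hb : Measurable b) (ha0 : ∀ z, 0 ≤ a z) (hb0 : ∀ z, 0 ≤ b z) :
    ∫⁻ z, ∫⁻ ζ, ENNReal.ofReal (a ζ ^ 3 * b z ^ 3 / dist ζ z)
      ≤ (∫⁻ z, ENNReal.ofReal (a z ^ 4)) * (∫⁻ z, ENNReal.ofReal (b z ^ 4))
        + ENNReal.ofReal (2 * Real.pi ^ 2) * (∫⁻ z, ENNReal.ofReal (a z ^ 4))
        + ENNReal.ofReal (2 * Real.pi ^ 2) * (∫⁻ z, ENNReal.ofReal (b z ^ 4)) := by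
  have hM : Measurable fun p : ℂ × ℂ => ENNReal.ofReal (rieszMajorant (a p.2) (dist p.2 p.1)) := by
    unfold rieszMajorant; fun_prop
  calc ∫⁻ z, ∫⁻ ζ, ENNReal.ofReal (a ζ ^ 3 * b z ^ 3 / dist ζ z)
      ≤ ∫⁻ z, ∫⁻ ζ, (ENNReal.ofReal (a ζ ^ 4) * ENNReal.ofReal (b z ^ 4)
          + ENNReal.ofReal (rieszMajorant (a ζ) (dist ζ z))
          + ENNReal.ofReal (rieszMajorant (b z) (dist ζ z))) := by
        refine lintegral_mono fun z => lintegral_mono fun ζ => ?_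
        have h1 := pow_nonneg (ha0 ζ) 4
        have h2 := rieszMajorant_nonneg (a ζ) (dist_nonneg (x := ζ) (y := z))
        have h3 := rieszMajorant_nonneg (b z) (dist_nonneg (x := ζ) (y := z))
        rw [← ENNReal.ofReal_mul h1, ← ENNReal.ofReal_add (by have := hb0 z; positivity) h2,
          ← ENNReal.ofReal_add (by have := hb0 z; positivity) h3]
        exact ENNReal.ofReal_le_ofReal
          (mul_div_le_add_rieszMajorant (ha0 ζ) (hb0 z) dist_nonneg)
    _ = ∫⁻ z, ((∫⁻ ζ, ENNReal.ofReal (a ζ ^ 4)) * ENNReal.ofReal (b z ^ 4)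
          + (∫⁻ ζ, ENNReal.ofReal (rieszMajorant (a ζ) (dist ζ z)))
          + ENNReal.ofReal (2 * Real.pi ^ 2) * ENNReal.ofReal (b z ^ 4)) := by
        refine lintegral_congr fun z => ?_
        rw [lintegral_add_right _ (by unfold rieszMajorant; fun_prop),
          lintegral_add_right _ (by unfold rieszMajorant; fun_prop),
          lintegral_mul_const _ (by fun_prop), lintegral_rieszMajorant_dist (hb0 z)]
    _ = _ := by
        rw [lintegral_add_right _ (by fun_prop), lintegral_add_right _ hM.lintegral_prod_right',
          lintegral_const_mul _ (by fun_prop), lintegral_const_mul _ (by fun_prop),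
          lintegral_lintegral_swap hM.aemeasurable]
        have hswap : ∀ ζ, ∫⁻ z, ENNReal.ofReal (rieszMajorant (a ζ) (dist ζ z))
            = ENNReal.ofReal (2 * Real.pi ^ 2) * ENNReal.ofReal (a ζ ^ 4) := fun ζ => by
          simpa only [dist_comm ζ] using lintegral_rieszMajorant_dist (ha0 ζ) ζ
        simp_rw [hswap]
        rw [lintegral_const_mul _ (by fun_prop)]

lemma pow_four_le_sq_div_add_sq {a v : ℝ} (hv : 0 < v) :
    a ^ 4 ≤ (a ^ 3) ^ 2 / v + v ^ 2 := by
  rcases le_total (a ^ 2) v with h | h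
  · have h1 : 0 ≤ (a ^ 3) ^ 2 / v := by positivity
    have h2 : (a ^ 2) ^ 2 ≤ v ^ 2 := by gcongr
    nlinarith
  · have : a ^ 4 ≤ (a ^ 3) ^ 2 / v := by
      rw [le_div_iff₀ hv]
      calc a ^ 4 * v ≤ a ^ 4 * a ^ 2 := by gcongr
        _ = _ := by ring
    nlinarith [sq_nonneg v]

lemma lintegral_pow_four_le_two {V a : ℂ → ℝ} (hV : Measurable V) (hV0 : ∀ z, 0 < V z)
    (hV1 : ∫⁻ z, ENNReal.ofReal (V z ^ 2) ≤ 1)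
    (ha1 : ∫⁻ z, ENNReal.ofReal ((a z ^ 3) ^ 2 / V z) ≤ 1) :
    ∫⁻ z, ENNReal.ofReal (a z ^ 4) ≤ 2 := by
  calc ∫⁻ z, ENNReal.ofReal (a z ^ 4)
      ≤ ∫⁻ z, (ENNReal.ofReal ((a z ^ 3) ^ 2 / V z) + ENNReal.ofReal (V z ^ 2)) := by
        refine lintegral_mono fun z => ?_
        rw [← ENNReal.ofReal_add (by have := hV0 z; positivity) (by positivity)]
        exact ENNReal.ofReal_le_ofReal (pow_four_le_sq_div_add_sq (hV0 z))
    _ = _ := lintegral_add_right _ (by fun_prop)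
    _ ≤ 1 + 1 := by gcongr
    _ = 2 := by norm_num

/-- The bilinear form of the weighted inequality, normalized. -/
lemma lintegral_lintegral_mul_div_dist_le_of_le_one {V f g : ℂ → ℝ} (hV : Measurable V)
    (hV0 : ∀ z, 0 < V z) (hf : Measurable f) (hf0 : ∀ z, 0 ≤ f z) (hg : Measurable g)
    (hg0 : ∀ z, 0 ≤ g z) (hV1 : ∫⁻ z, ENNReal.ofReal (V z ^ 2) ≤ 1)
    (hf1 : ∫⁻ z, ENNReal.ofReal (f z ^ 2 / V z) ≤ 1)
    (hg1 : ∫⁻ z, ENNReal.ofReal (g z ^ 2 / V z) ≤ 1) :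
    ∫⁻ z, ∫⁻ ζ, ENNReal.ofReal (f ζ * g z / dist ζ z)
      ≤ ENNReal.ofReal (4 + 8 * Real.pi ^ 2) := by
  have hcube : ∀ x : ℝ, 0 ≤ x → (x ^ (3⁻¹ : ℝ)) ^ 3 = x := fun x hx => by
    simpa using Real.rpow_inv_natCast_pow hx (n := 3) (by norm_num)
  have hfa : ∀ z, (f z ^ (3⁻¹ : ℝ)) ^ 3 = f z := fun z => hcube _ (hf0 z)
  have hgb : ∀ z, (g z ^ (3⁻¹ : ℝ)) ^ 3 = g z := fun z => hcube _ (hg0 z)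
  have ha := lintegral_pow_four_le_two (a := fun z => f z ^ (3⁻¹ : ℝ)) hV hV0 hV1
    (by simpa only [hfa] using hf1)
  have hb := lintegral_pow_four_le_two (a := fun z => g z ^ (3⁻¹ : ℝ)) hV hV0 hV1
    (by simpa only [hgb] using hg1)
  have h := lintegral_lintegral_cube_mul_cube_div_dist_le
    (a := fun z => f z ^ (3⁻¹ : ℝ)) (b := fun z => g z ^ (3⁻¹ : ℝ)) (by fun_prop) (by fun_prop)
    (fun z => Real.rpow_nonneg (hf0 z) _) (fun z => Real.rpow_nonneg (hg0 z) _)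
  simp only [hfa, hgb] at h
  refine h.trans ((add_le_add (add_le_add (mul_le_mul' ha hb) (mul_le_mul_right ha _))
    (mul_le_mul_right hb _)).trans_eq ?_)
  rw [show (2 : ENNReal) = ENNReal.ofReal 2 by simp, ← ENNReal.ofReal_mul (by positivity),
    ← ENNReal.ofReal_mul (by positivity), ← ENNReal.ofReal_add (by positivity) (by positivity),
    ← ENNReal.ofReal_add (by positivity) (by positivity)]
  congr 1
  ring

lemma lintegral_ofReal_mul_le_one {h : ℂ → ℝ} {c : ℝ} (hc : 0 < c)
    (hh : ∫⁻ z, ENNReal.ofReal (h z) ≤ ENNReal.ofReal c) :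
    ∫⁻ z, ENNReal.ofReal (c⁻¹ * h z) ≤ 1 := by
  simp_rw [ENNReal.ofReal_mul (inv_nonneg.2 hc.le)]
  rw [lintegral_const_mul' _ _ ENNReal.ofReal_ne_top]
  calc _ ≤ ENNReal.ofReal c⁻¹ * ENNReal.ofReal c := by gcongr
    _ = 1 := by rw [← ENNReal.ofReal_mul (by positivity), inv_mul_cancel₀ hc.ne']; simp

/-- The bilinear form of the weighted inequality. -/
lemma lintegral_lintegral_mul_div_dist_le {V f g : ℂ → ℝ} {A E J : ℝ} (hV : Measurable V)
    (hV0 : ∀ z, 0 < V z) (hf : Measurable f) (hf0 : ∀ z, 0 ≤ f z) (hg : Measurable g)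
    (hg0 : ∀ z, 0 ≤ g z) (hA : 0 < A) (hE : 0 < E) (hJ : 0 < J)
    (hV1 : ∫⁻ z, ENNReal.ofReal (V z ^ 2) ≤ ENNReal.ofReal (A ^ 2))
    (hf1 : ∫⁻ z, ENNReal.ofReal (f z ^ 2 / V z) ≤ ENNReal.ofReal (E ^ 2))
    (hg1 : ∫⁻ z, ENNReal.ofReal (g z ^ 2 / V z) ≤ ENNReal.ofReal (J ^ 2)) :
    ∫⁻ z, ∫⁻ ζ, ENNReal.ofReal (f ζ * g z / dist ζ z)
      ≤ ENNReal.ofReal ((4 + 8 * Real.pi ^ 2) * (A * E * J)) := by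
  obtain ⟨c, hc, rfl⟩ : ∃ c : ℝ, 0 < c ∧ A = c ^ 2 :=
    ⟨√A, Real.sqrt_pos.2 hA, (Real.sq_sqrt hA.le).symm⟩
  have hscale : ∀ {h : ℂ → ℝ} {H : ℝ}, 0 < H →
      ∫⁻ z, ENNReal.ofReal (h z ^ 2 / V z) ≤ ENNReal.ofReal (H ^ 2) →
      ∫⁻ z, ENNReal.ofReal ((h z / (H * c)) ^ 2 / (V z / c ^ 2)) ≤ 1 := by
    intro h H hH hh
    refine (lintegral_ofReal_mul_le_one (by positivity) hh).trans_eq' ?_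
    refine lintegral_congr fun z => ?_
    have := (hV0 z).ne'
    congr 1
    field_simp
  have hV1' : ∫⁻ z, ENNReal.ofReal ((V z / c ^ 2) ^ 2) ≤ 1 := by
    refine (lintegral_ofReal_mul_le_one (by positivity) hV1).trans_eq' ?_
    refine lintegral_congr fun z => ?_
    congr 1
    field_simp
  have h := lintegral_lintegral_mul_div_dist_le_of_le_one (V := fun z => V z / c ^ 2)
    (f := fun z => f z / (E * c)) (g := fun z => g z / (J * c)) (by fun_prop)
    (fun z => div_pos (hV0 z) (by positivity)) (by fun_prop)
    (fun z => div_nonneg (hf0 z) (by positivity)) (by fun_prop)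
    (fun z => div_nonneg (hg0 z) (by positivity)) hV1' (hscale hE hf1) (hscale hJ hg1)
  have hpt : ∀ z ζ, ENNReal.ofReal (f ζ * g z / dist ζ z) = ENNReal.ofReal (c ^ 2 * E * J) *
      ENNReal.ofReal (f ζ / (E * c) * (g z / (J * c)) / dist ζ z) := by
    intro z ζ
    rw [← ENNReal.ofReal_mul (by positivity)]
    congr 1
    rcases (dist_nonneg (x := ζ) (y := z)).eq_or_lt with h0 | h0
    · simp [← h0]
    · field_simp
  simp_rw [hpt, lintegral_const_mul' _ _ ENNReal.ofReal_ne_top]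
  rw [mul_comm (4 + 8 * Real.pi ^ 2),
    ENNReal.ofReal_mul (p := c ^ 2 * E * J) (by positivity)]
  exact mul_le_mul_right h _

/-- If a truncation `u ≤ F` of the potential `F` of `f` is square integrable with respect to `V`,
then its norm is controlled by duality. -/
lemma lintegral_sq_mul_le_of_le_potential {V f u : ℂ → ℝ} {A E : ℝ} (hV : Measurable V)
    (hV0 : ∀ z, 0 < V z) (hf : Measurable f) (hf0 : ∀ z, 0 ≤ f z) (hu : Measurable u)
    (hu0 : ∀ z, 0 ≤ u z) (hA : 0 < A) (hE : 0 < E)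
    (hV1 : ∫⁻ z, ENNReal.ofReal (V z ^ 2) ≤ ENNReal.ofReal (A ^ 2))
    (hf1 : ∫⁻ z, ENNReal.ofReal (f z ^ 2 / V z) ≤ ENNReal.ofReal (E ^ 2))
    (huF : ∀ z, ENNReal.ofReal (u z) ≤ ∫⁻ ζ, ENNReal.ofReal (f ζ / dist ζ z))
    (hfin : ∫⁻ z, ENNReal.ofReal (u z ^ 2 * V z) ≠ ⊤) :
    ∫⁻ z, ENNReal.ofReal (u z ^ 2 * V z)
      ≤ ENNReal.ofReal (((4 + 8 * Real.pi ^ 2) * (A * E)) ^ 2) := by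
  obtain ⟨J, hJ0, hJ⟩ : ∃ J : ℝ, 0 ≤ J ∧
      ∫⁻ z, ENNReal.ofReal (u z ^ 2 * V z) = ENNReal.ofReal (J ^ 2) :=
    ⟨√(∫⁻ z, ENNReal.ofReal (u z ^ 2 * V z)).toReal, Real.sqrt_nonneg _, by
      rw [Real.sq_sqrt ENNReal.toReal_nonneg, ENNReal.ofReal_toReal hfin]⟩
  rw [hJ]
  rcases hJ0.eq_or_lt with rfl | hJpos
  · simp
  have hg1 : ∫⁻ z, ENNReal.ofReal ((u z * V z) ^ 2 / V z) ≤ ENNReal.ofReal (J ^ 2) := by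
    rw [← hJ]
    refine (lintegral_congr fun z => ?_).le
    have := (hV0 z).ne'
    congr 1
    field_simp
  have hbil := lintegral_lintegral_mul_div_dist_le (g := fun z => u z * V z) hV hV0 hf hf0
    (by fun_prop) (fun z => mul_nonneg (hu0 z) (hV0 z).le) hA hE hJpos hV1 hf1 hg1
  have hle : ENNReal.ofReal (J ^ 2) ≤
      ∫⁻ z, ∫⁻ ζ, ENNReal.ofReal (f ζ * (u z * V z) / dist ζ z) := by
    rw [← hJ]
    refine lintegral_mono fun z => ?_
    have huV : 0 ≤ u z * V z := mul_nonneg (hu0 z) (hV0 z).le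
    calc ENNReal.ofReal (u z ^ 2 * V z)
        = ENNReal.ofReal (u z * V z) * ENNReal.ofReal (u z) := by
          rw [← ENNReal.ofReal_mul huV]; congr 1; ring
      _ ≤ ENNReal.ofReal (u z * V z) * ∫⁻ ζ, ENNReal.ofReal (f ζ / dist ζ z) := by
          gcongr; exact huF z
      _ = _ := by
          rw [← lintegral_const_mul' _ _ ENNReal.ofReal_ne_top]
          refine lintegral_congr fun ζ => ?_
          rw [← ENNReal.ofReal_mul huV]
          congr 1
          ring
  have hreal : J ^ 2 ≤ (4 + 8 * Real.pi ^ 2) * (A * E * J) :=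
    (ENNReal.ofReal_le_ofReal_iff (by positivity)).1 (hle.trans hbil)
  have hJle : J ≤ (4 + 8 * Real.pi ^ 2) * (A * E) := by
    refine le_of_mul_le_mul_right ?_ hJpos
    calc J * J = J ^ 2 := by ring
      _ ≤ _ := hreal
      _ = _ := by ring
  gcongr

/-- Removing the truncation by monotone convergence. -/
lemma lintegral_sq_potential_mul_le {V f : ℂ → ℝ} {A E : ℝ} (hV : Measurable V)
    (hV0 : ∀ z, 0 < V z) (hf : Measurable f) (hf0 : ∀ z, 0 ≤ f z) (hA : 0 < A) (hE : 0 < E)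
    (hV1 : ∫⁻ z, ENNReal.ofReal (V z ^ 2) ≤ ENNReal.ofReal (A ^ 2))
    (hf1 : ∫⁻ z, ENNReal.ofReal (f z ^ 2 / V z) ≤ ENNReal.ofReal (E ^ 2)) :
    ∫⁻ z, (∫⁻ ζ, ENNReal.ofReal (f ζ / dist ζ z)) ^ 2 * ENNReal.ofReal (V z)
      ≤ ENNReal.ofReal (((4 + 8 * Real.pi ^ 2) * (A * E)) ^ 2) := by
  set F : ℂ → ENNReal := fun z => ∫⁻ ζ, ENNReal.ofReal (f ζ / dist ζ z)
  have hFm : Measurable F := by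
    have : Measurable fun p : ℂ × ℂ => ENNReal.ofReal (f p.2 / dist p.2 p.1) := by fun_prop
    exact this.lintegral_prod_right'
  let G : ℕ → ℂ → ENNReal := fun n z => min (F z) (ENNReal.ofReal (n * √(V z)))
  have hGtop : ∀ n z, G n z ≠ ⊤ := fun n z => ((min_le_right _ _).trans_lt ENNReal.ofReal_lt_top).ne
  have hGm : ∀ n, Measurable (G n) := fun n => hFm.min (by fun_prop)
  have hGmono : ∀ z, Monotone fun n => G n z := fun z m n hmn =>
    min_le_min_left _ (ENNReal.ofReal_le_ofReal (by gcongr))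
  have hGlim : ∀ z, Filter.Tendsto (fun n => G n z) Filter.atTop (nhds (F z)) := by
    intro z
    have htop : Filter.Tendsto (fun n : ℕ => ENNReal.ofReal (n * √(V z))) Filter.atTop (nhds ⊤) :=
      ENNReal.tendsto_ofReal_atTop.comp
        (tendsto_natCast_atTop_atTop.atTop_mul_const (Real.sqrt_pos.2 (hV0 z)))
    simpa only [min_top_right] using (tendsto_const_nhds (x := F z)).min htop
  have hbound : ∀ n, ∫⁻ z, G n z ^ 2 * ENNReal.ofReal (V z)
      ≤ ENNReal.ofReal (((4 + 8 * Real.pi ^ 2) * (A * E)) ^ 2) := by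
    intro n
    have hG : ∀ z, G n z ^ 2 * ENNReal.ofReal (V z)
        = ENNReal.ofReal ((G n z).toReal ^ 2 * V z) := fun z => by
      rw [ENNReal.ofReal_mul (by positivity), ENNReal.ofReal_pow ENNReal.toReal_nonneg,
        ENNReal.ofReal_toReal (hGtop n z)]
    simp_rw [hG]
    refine lintegral_sq_mul_le_of_le_potential hV hV0 hf hf0 (hGm n).ennreal_toReal
      (fun z => ENNReal.toReal_nonneg) hA hE hV1 hf1
      (fun z => (ENNReal.ofReal_toReal_le).trans (min_le_left _ _)) ?_
    refine ne_top_of_le_ne_top (b := ENNReal.ofReal (n ^ 2) * ENNReal.ofReal (A ^ 2))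
      (ENNReal.mul_ne_top ENNReal.ofReal_ne_top ENNReal.ofReal_ne_top) ?_
    refine le_trans ?_ (mul_le_mul_right hV1 _)
    rw [← lintegral_const_mul' _ _ ENNReal.ofReal_ne_top]
    refine lintegral_mono fun z => ?_
    rw [← ENNReal.ofReal_mul (by positivity)]
    refine ENNReal.ofReal_le_ofReal ?_
    have hV0z := (hV0 z).le
    have hle : (G n z).toReal ≤ n * √(V z) :=
      ENNReal.toReal_le_of_le_ofReal (by positivity) (min_le_right _ _)
    calc (G n z).toReal ^ 2 * V z ≤ (n * √(V z)) ^ 2 * V z := by gcongr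
      _ = n ^ 2 * V z ^ 2 := by rw [mul_pow, Real.sq_sqrt hV0z]; ring
  refine le_of_tendsto' (lintegral_tendsto_of_tendsto_of_monotone
    (f := fun n z => G n z ^ 2 * ENNReal.ofReal (V z)) (fun n => by fun_prop)
    (.of_forall fun z m n hmn => by have := hGmono z hmn; dsimp only at this ⊢; gcongr)
    (.of_forall fun z => ?_)) hbound
  exact ENNReal.Tendsto.mul_const (ENNReal.Tendsto.pow (hGlim z)) (.inr ENNReal.ofReal_ne_top)

/-- **Weighted Hardy–Littlewood–Sobolev inequality for the Riesz potential `I₁` with an `L²`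
weight.**  There is a universal constant `C₀ > 0` such that for every measurable weight
`V : ℂ → (0,∞)` with `V ∈ L²(ℂ)` and every measurable `f : ℂ → [0,∞)` with
`∫ f² V⁻¹ < ∞`, one has
`∫ (∫ f(ζ)/|ζ−z| dζ)² V(z) dz ≤ C₀² (∫ V²) (∫ f² V⁻¹)`,
i.e. `‖I₁ f‖_{L²_V(ℂ)} ≤ C₀ ‖V‖_{L²(ℂ)} ‖f‖_{L²_{V⁻¹}(ℂ)}`. -/
theorem weighted_HLS_inequality_I1_L2_weight :
    ∃ C₀ : ℝ, 0 < C₀ ∧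
      ∀ (V f : ℂ → ℝ), Measurable V → (∀ z, 0 < V z) → Measurable f → (∀ z, 0 ≤ f z) →
        (∫⁻ z, ENNReal.ofReal (V z ^ 2)) < ⊤ →
        (∫⁻ z, ENNReal.ofReal (f z ^ 2 / V z)) < ⊤ →
        ∫⁻ z, (∫⁻ ζ, ENNReal.ofReal (f ζ / dist ζ z)) ^ 2 * ENNReal.ofReal (V z)
          ≤ ENNReal.ofReal (C₀ ^ 2) * (∫⁻ z, ENNReal.ofReal (V z ^ 2)) *
              (∫⁻ z, ENNReal.ofReal (f z ^ 2 / V z)) := by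
  refine ⟨4 + 8 * Real.pi ^ 2, by positivity, fun V f hV hV0 hf hf0 hVfin hffin => ?_⟩
  rcases eq_or_ne (∫⁻ z, ENNReal.ofReal (f z ^ 2 / V z)) 0 with hf1 | hf1
  · have hfz : ∀ᵐ ζ, f ζ = 0 := by
      rw [lintegral_eq_zero_iff (by fun_prop)] at hf1
      filter_upwards [hf1] with ζ hζ
      have hle := ENNReal.ofReal_eq_zero.1 hζ
      rw [div_le_iff₀ (hV0 ζ), zero_mul] at hle
      exact pow_eq_zero_iff two_ne_zero |>.1 (le_antisymm hle (sq_nonneg _))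
    have hpot : ∀ z, ∫⁻ ζ, ENNReal.ofReal (f ζ / dist ζ z) = 0 := fun z => by
      refine (lintegral_congr_ae (g := 0) ?_).trans (by simp)
      filter_upwards [hfz] with ζ hζ
      simp [hζ]
    simp [hpot]
  have hVpos : ∫⁻ z, ENNReal.ofReal (V z ^ 2) ≠ 0 := by
    rw [Ne, lintegral_eq_zero_iff (by fun_prop)]
    intro h
    obtain ⟨z, hz⟩ := h.exists
    exact (pow_pos (hV0 z) 2).not_ge (ENNReal.ofReal_eq_zero.1 hz)
  have hroot : ∀ {x : ENNReal}, x ≠ 0 → x ≠ ⊤ → ∃ r : ℝ, 0 < r ∧ x = ENNReal.ofReal (r ^ 2) :=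
    fun {x} h0 htop => ⟨√x.toReal, Real.sqrt_pos.2 (ENNReal.toReal_pos h0 htop), by
      rw [Real.sq_sqrt ENNReal.toReal_nonneg, ENNReal.ofReal_toReal htop]⟩
  obtain ⟨A, hA, hVA⟩ := hroot hVpos hVfin.ne
  obtain ⟨E, hE, hfE⟩ := hroot hf1 hffin.ne
  refine (lintegral_sq_potential_mul_le hV hV0 hf hf0 hA hE hVA.le hfE.le).trans_eq ?_
  rw [hVA, hfE, ← ENNReal.ofReal_mul (by positivity), ← ENNReal.ofReal_mul (by positivity)]
  congr 1
  ring
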